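/- For a field 𝔽 of characteristic 0 and n ≥ 2, the polynomial Δ₁₂(f_{2n+1}) = (x₃ − x_{2n+1})·∏_{i=3}^{2n}(x_i x_{i+1}+1) cannot be written as a product g·h of two polynomials g, h ∈ 𝔽̄[x_1,...,x_{2n+1}] each of degree ≤ 1 in every variable (where 𝔽̄ is the algebraic closure of 𝔽). Consequently, f_{2n+1} is not of the form det(diag(x_1,...,x_{2n+1}) + A) for any (2n+1)×(2n+1) matrix A over 𝔽. -/

import Mathlib

open MvPolynomial Matrix

/-- The index of the paper's variable `x_m` (`1 ≤ m ≤ 2n+1`) in `Fin (2n+1)`,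
with the paper's convention `x_{2n+2} = x_2`. -/
def pIdx (n m : ℕ) : Fin (2 * n + 1) :=
  ⟨(if m = 2 * n + 2 then 1 else m - 1) % (2 * n + 1), Nat.mod_lt _ (by omega)⟩

/-- The polynomial
`f_{2n+1} = x₁·∏_{j=1}^{n}(x_{2j+1}x_{2j+2} + 1) + ∏_{j=1}^{n}(x_{2j}x_{2j+1} + 1)`
with the convention `x_{2n+2} = x₂`. -/
noncomputable def fOdd (F : Type*) [Field F] (n : ℕ) :
    MvPolynomial (Fin (2 * n + 1)) F :=
  X (pIdx n 1) *
      ∏ j ∈ Finset.range n, (X (pIdx n (2 * j + 3)) * X (pIdx n (2 * j + 4)) + 1) +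
    ∏ j ∈ Finset.range n, (X (pIdx n (2 * j + 2)) * X (pIdx n (2 * j + 3)) + 1)

section aux
variable {σ K : Type*} [Field K]

lemma aux_subst_of_degreeOf_zero [DecidableEq σ] (s : σ) (q b : MvPolynomial σ K)
    (hb : degreeOf s b = 0) : aeval (Function.update X s q) b = b := by
  have h1 : aeval (Function.update X s q) b = aeval (X : σ → MvPolynomial σ K) b := by
    refine eval₂Hom_congr' rfl ?_ rfl
    intro i hi _
    by_cases his : i = s
    · subst his
      exact absurd hb (by
        rw [degreeOf_def]
        intro h0
        rw [Multiset.count_eq_zero] at h0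
        exact h0 (by simpa [vars_def] using hi))
    · simp [Function.update_of_ne his]
  rw [h1, aeval_X_left_apply]

lemma aux_prime [DecidableEq σ] (s : σ) (p q : MvPolynomial σ K)
    (hs : degreeOf s p = 1) (hq : aeval (Function.update X s q) p = 1) : Prime p := by
  have hp0 : p ≠ 0 := by rintro rfl; simp at hs
  refine Irreducible.prime ⟨?_, ?_⟩
  · intro hu
    obtain ⟨r, hr⟩ := hu.exists_right_inv
    have hr0 : r ≠ 0 := by rintro rfl; simp at hr
    have := degreeOf_mul_eq (n := s) hp0 hr0
    rw [hr, degreeOf_one] at this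
    omega
  · intro a b hab
    have ha0 : a ≠ 0 := by rintro rfl; simp at hab; exact hp0 hab
    have hb0 : b ≠ 0 := by rintro rfl; simp at hab; exact hp0 hab
    have h := degreeOf_mul_eq (n := s) ha0 hb0
    rw [← hab, hs] at h
    rw [hab, map_mul] at hq
    rcases (show degreeOf s a = 0 ∨ degreeOf s b = 0 by omega) with h0 | h0
    · left
      rw [aux_subst_of_degreeOf_zero s q a h0] at hq
      exact IsUnit.of_mul_eq_one _ hq
    · right
      rw [aux_subst_of_degreeOf_zero s q b h0] at hq
      exact IsUnit.of_mul_eq_one_right _ hq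

lemma aux_adj (t u : σ) (p q g : MvPolynomial σ K) (hq : Prime q)
    (hpt : degreeOf t p = 1) (hqt : degreeOf t q = 1) (hqu : degreeOf u q = 1)
    (hpu : degreeOf u p = 0) (hg0 : g ≠ 0) (hg : degreeOf t g ≤ 1)
    (h1 : p ∣ g) (h2 : q ∣ g) : False := by
  obtain ⟨k, rfl⟩ := h1
  have hp0 : p ≠ 0 := left_ne_zero_of_mul hg0
  have hk0 : k ≠ 0 := right_ne_zero_of_mul hg0
  rcases hq.dvd_or_dvd h2 with ⟨r, rfl⟩ | ⟨r, rfl⟩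
  · have := degreeOf_mul_eq (n := u) hq.ne_zero (right_ne_zero_of_mul hp0)
    omega
  · have h3 := degreeOf_mul_eq (n := t) hp0 hk0
    have h4 := degreeOf_mul_eq (n := t) hq.ne_zero (right_ne_zero_of_mul hk0)
    omega

lemma aux_deg_edge [DecidableEq σ] (a b t : σ) (hab : a ≠ b) :
    degreeOf t (X a * X b + 1 : MvPolynomial σ K) = if t = a ∨ t = b then 1 else 0 := by
  have hm : degreeOf t (X a * X b : MvPolynomial σ K) = if t = a ∨ t = b then 1 else 0 := by
    rw [degreeOf_mul_eq (X_ne_zero a) (X_ne_zero b), degreeOf_X, degreeOf_X]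
    by_cases h1 : t = a
    · subst h1; simp [hab]
    · simp [h1]
  split_ifs at hm ⊢ with h
  · rw [degreeOf_add_eq_of_degreeOf_lt, hm]
    rw [hm, degreeOf_one]; exact one_pos
  · have := degreeOf_add_le t (X a * X b : MvPolynomial σ K) 1
    rw [hm, degreeOf_one] at this
    simpa using this

lemma aux_deg_close [DecidableEq σ] (a b t : σ) (hab : a ≠ b) :
    degreeOf t (X a - X b : MvPolynomial σ K) = if t = a ∨ t = b then 1 else 0 := by
  have hn : degreeOf t (-X b : MvPolynomial σ K) = if t = b then 1 else 0 := by
    rw [degreeOf_neg, degreeOf_X]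
  rw [sub_eq_add_neg]
  by_cases h1 : t = a
  · subst h1
    rw [degreeOf_add_eq_of_degreeOf_lt] <;> simp [hn, hab]
  · by_cases h2 : t = b
    · subst h2
      rw [add_comm, degreeOf_add_eq_of_degreeOf_lt] <;> simp [degreeOf_X, h1]
    · have := degreeOf_add_le t (X a : MvPolynomial σ K) (-X b)
      rw [hn, degreeOf_X] at this
      simp [h1, h2] at this ⊢
      exact this

lemma aux_prime_edge [DecidableEq σ] (a b : σ) (hab : a ≠ b) :
    Prime (X a * X b + 1 : MvPolynomial σ K) := by
  refine aux_prime a _ 0 ?_ ?_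
  · simp [aux_deg_edge a b a hab]
  · simp

lemma aux_prime_close [DecidableEq σ] (a b : σ) (hab : a ≠ b) :
    Prime (X a - X b : MvPolynomial σ K) := by
  refine aux_prime a _ (X b + 1) ?_ ?_
  · simp [aux_deg_close a b a hab]
  · simp [Function.update_of_ne hab.symm]

lemma aux_pIdx_val (n i : ℕ) (h1 : 1 ≤ i) (h2 : i ≤ 2 * n + 1) : (pIdx n i).val = i - 1 := by
  simp only [pIdx]
  rw [if_neg (by omega), Nat.mod_eq_of_lt (by omega)]

lemma aux_pIdx_ne (n i j : ℕ) (h1 : 1 ≤ i) (h2 : i ≤ 2 * n + 1) (h3 : 1 ≤ j) (h4 : j ≤ 2 * n + 1)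
    (hij : i ≠ j) : pIdx n i ≠ pIdx n j := by
  intro h
  have := congrArg Fin.val h
  rw [aux_pIdx_val n i h1 h2, aux_pIdx_val n j h3 h4] at this
  omega

lemma aux_logic1 {p q r s : Prop} (a1 : p → q → False) (a2 : r → s → False)
    (a3 : p ∨ r) (a4 : q ∨ s) : q ↔ ¬ p := by tauto

lemma aux_logic2 {p q : Prop} : ¬ (p ↔ q) ↔ (p ↔ ¬ q) := by tauto

lemma aux_logic3 {cg ch g3 h3 gl hl e : Prop} (h : gl ↔ (g3 ↔ e)) (he : ¬ e)
    (b1 : cg → g3 → False) (b2 : ch → h3 → False) (b3 : cg → gl → False) (b4 : ch → hl → False)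
    (b5 : g3 ∨ h3) (b6 : gl ∨ hl) (b7 : cg ∨ ch) : False := by tauto

lemma aux_part1 (K : Type*) [Field K] (n : ℕ) (hn : 2 ≤ n)
    (g h : MvPolynomial (Fin (2 * n + 1)) K)
    (hgh : (X (pIdx n 3) - X (pIdx n (2 * n + 1))) *
            ∏ i ∈ Finset.Icc 3 (2 * n), (X (pIdx n i) * X (pIdx n (i + 1)) + 1) = g * h)
    (hg : ∀ t, g.degreeOf t ≤ 1) (hh : ∀ t, h.degreeOf t ≤ 1) : False := by
  have ne := aux_pIdx_ne n
  set E : ℕ → MvPolynomial (Fin (2 * n + 1)) K :=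
    fun i => X (pIdx n i) * X (pIdx n (i + 1)) + 1 with hE
  set c : MvPolynomial (Fin (2 * n + 1)) K := X (pIdx n 3) - X (pIdx n (2 * n + 1)) with hc
  have hcp : Prime c := aux_prime_close _ _ (ne _ _ (by omega) (by omega) (by omega) (by omega) (by omega))
  have hEp : ∀ i, 3 ≤ i → i ≤ 2 * n → Prime (E i) := fun i h1 h2 =>
    aux_prime_edge _ _ (ne _ _ (by omega) (by omega) (by omega) (by omega) (by omega))
  have hprod : (∏ i ∈ Finset.Icc 3 (2 * n), E i) ≠ 0 := by
    rw [Finset.prod_ne_zero_iff]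
    intro i hi
    rw [Finset.mem_Icc] at hi
    exact (hEp i hi.1 hi.2).ne_zero
  have h0 : g * h ≠ 0 := by
    rw [← hgh]
    exact mul_ne_zero hcp.ne_zero hprod
  have hg0 := left_ne_zero_of_mul h0
  have hh0 := right_ne_zero_of_mul h0
  have hEd : ∀ i t, 3 ≤ i → i ≤ 2 * n → degreeOf t (E i) =
      if t = pIdx n i ∨ t = pIdx n (i + 1) then 1 else 0 := fun i t h1 h2 =>
    aux_deg_edge _ _ _ (ne _ _ (by omega) (by omega) (by omega) (by omega) (by omega))
  have hcd : ∀ t, degreeOf t c =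
      if t = pIdx n 3 ∨ t = pIdx n (2 * n + 1) then 1 else 0 := fun t =>
    aux_deg_close _ _ _ (ne _ _ (by omega) (by omega) (by omega) (by omega) (by omega))
  have hEor : ∀ i, 3 ≤ i → i ≤ 2 * n → E i ∣ g ∨ E i ∣ h := fun i h1 h2 => by
    apply (hEp i h1 h2).dvd_or_dvd
    rw [← hgh]
    exact Dvd.dvd.mul_left (Finset.dvd_prod_of_mem E (Finset.mem_Icc.2 ⟨h1, h2⟩)) _
  have hcor : c ∣ g ∨ c ∣ h := by
    apply hcp.dvd_or_dvd
    rw [← hgh]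
    exact dvd_mul_right _ _
  have adj : ∀ k : MvPolynomial (Fin (2 * n + 1)) K, k ≠ 0 → (∀ t, k.degreeOf t ≤ 1) →
      ∀ i, 3 ≤ i → i + 1 ≤ 2 * n → E i ∣ k → E (i + 1) ∣ k → False := by
    intro k hk0 hk i h1 h2
    refine aux_adj (pIdx n (i + 1)) (pIdx n (i + 1 + 1)) _ _ k (hEp _ (by omega) h2) ?_ ?_ ?_ ?_ hk0 (hk _)
    · rw [hEd i _ h1 (by omega)]; simp
    · rw [hEd (i+1) _ (by omega) h2]; simp
    · rw [hEd (i+1) _ (by omega) h2]; simp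
    · rw [hEd i _ h1 (by omega), if_neg]
      rintro (h | h)
      · exact ne _ _ (by omega) (by omega) (by omega) (by omega) (by omega) h
      · exact ne _ _ (by omega) (by omega) (by omega) (by omega) (by omega) h
  have adj3 : ∀ k : MvPolynomial (Fin (2 * n + 1)) K, k ≠ 0 → (∀ t, k.degreeOf t ≤ 1) →
      c ∣ k → E 3 ∣ k → False := by
    intro k hk0 hk hck hek
    refine aux_adj (pIdx n 3) (pIdx n (2 * n + 1)) (E 3) c k hcp ?_ ?_ ?_ ?_ hk0 (hk _) hek hck
    · rw [hEd 3 _ (by omega) (by omega)]; simp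
    · rw [hcd]; simp
    · rw [hcd]; simp
    · rw [hEd 3 _ (by omega) (by omega), if_neg]
      rintro (h | h)
      · exact ne _ _ (by omega) (by omega) (by omega) (by omega) (by omega) h
      · exact ne _ _ (by omega) (by omega) (by omega) (by omega) (by omega) h
  have adjn : ∀ k : MvPolynomial (Fin (2 * n + 1)) K, k ≠ 0 → (∀ t, k.degreeOf t ≤ 1) →
      c ∣ k → E (2 * n) ∣ k → False := by
    intro k hk0 hk hck hek
    refine aux_adj (pIdx n (2 * n + 1)) (pIdx n 3) (E (2 * n)) c k hcp ?_ ?_ ?_ ?_ hk0 (hk _) hek hck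
    · rw [hEd (2 * n) _ (by omega) (by omega)]; simp
    · rw [hcd]; simp
    · rw [hcd]; simp
    · rw [hEd (2 * n) _ (by omega) (by omega), if_neg]
      rintro (h | h)
      · exact ne _ _ (by omega) (by omega) (by omega) (by omega) (by omega) h
      · exact ne _ _ (by omega) (by omega) (by omega) (by omega) (by omega) h
  have step : ∀ i, 3 ≤ i → i + 1 ≤ 2 * n → (E (i + 1) ∣ g ↔ ¬ E i ∣ g) := by
    intro i h1 h2
    have a1 := adj g hg0 hg i h1 h2
    have a2 := adj h hh0 hh i h1 h2
    have a3 := hEor i h1 (by omega)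
    have a4 := hEor (i + 1) (by omega) h2
    exact aux_logic1 a1 a2 a3 a4
  have ind : ∀ k, 3 + k ≤ 2 * n → (E (3 + k) ∣ g ↔ (E 3 ∣ g ↔ Even k)) := by
    intro k
    induction k with
    | zero => simp
    | succ k ih =>
      intro hk
      have := step (3 + k) (by omega) (by omega)
      rw [← add_assoc, this, ih (by omega), Nat.even_add_one]
      exact aux_logic2
  have hlast := ind (2 * n - 3) (by omega)
  have hodd : ¬ Even (2 * n - 3) := by
    rw [Nat.not_even_iff_odd]; exact ⟨n - 2, by omega⟩
  rw [show 3 + (2 * n - 3) = 2 * n by omega] at hlast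
  have b1 := adj3 g hg0 hg
  have b2 := adj3 h hh0 hh
  have b3 := adjn g hg0 hg
  have b4 := adjn h hh0 hh
  have b5 := hEor 3 (by omega) (by omega)
  have b6 := hEor (2 * n) (by omega) (by omega)
  exact aux_logic3 hlast hodd b1 b2 b3 b4 b5 b6 hcor

lemma aux_schur {κ L : Type*} [Fintype κ] [DecidableEq κ] [Field L]
    (B : Matrix (Fin 2) (Fin 2) L) (U : Matrix (Fin 2) κ L) (V : Matrix κ (Fin 2) L)
    (D : Matrix κ κ L) (hD : D.det ≠ 0) :
    (fromBlocks (B + diagonal ![1, 0]) U V D).det * (fromBlocks (B + diagonal ![0, 1]) U V D).det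
      - (fromBlocks (B + diagonal ![0, 0]) U V D).det * (fromBlocks (B + diagonal ![1, 1]) U V D).det
    = (fromBlocks (B.submatrix (fun _ : Unit => 0) (fun _ : Unit => 1))
        (U.submatrix (fun _ : Unit => 0) id) (V.submatrix id (fun _ : Unit => 1)) D).det *
      (fromBlocks (B.submatrix (fun _ : Unit => 1) (fun _ : Unit => 0))
        (U.submatrix (fun _ : Unit => 1) id) (V.submatrix id (fun _ : Unit => 0)) D).det := by
  have : Invertible D := D.invertibleOfIsUnitDet hD.isUnit
  simp only [det_fromBlocks₂₂]
  have key : ∀ i j : Fin 2, (B.submatrix (fun _ : Unit => i) (fun _ : Unit => j) -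
      U.submatrix (fun _ : Unit => i) id * ⅟D * V.submatrix id (fun _ : Unit => j)).det
      = (B - U * ⅟D * V) i j := by
    intro i j
    rw [det_unique]
    simp [Matrix.mul_apply]
  rw [key, key]
  simp only [det_fin_two, Matrix.sub_apply, Matrix.add_apply]
  simp [diagonal]
  ring

lemma aux_schur' {κ R : Type*} [Fintype κ] [DecidableEq κ] [CommRing R] [IsDomain R]
    (B : Matrix (Fin 2) (Fin 2) R) (U : Matrix (Fin 2) κ R) (V : Matrix κ (Fin 2) R)
    (D : Matrix κ κ R) (hD : D.det ≠ 0) :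
    (fromBlocks (B + diagonal ![1, 0]) U V D).det * (fromBlocks (B + diagonal ![0, 1]) U V D).det
      - (fromBlocks (B + diagonal ![0, 0]) U V D).det * (fromBlocks (B + diagonal ![1, 1]) U V D).det
    = (fromBlocks (B.submatrix (fun _ : Unit => 0) (fun _ : Unit => 1))
        (U.submatrix (fun _ : Unit => 0) id) (V.submatrix id (fun _ : Unit => 1)) D).det *
      (fromBlocks (B.submatrix (fun _ : Unit => 1) (fun _ : Unit => 0))
        (U.submatrix (fun _ : Unit => 1) id) (V.submatrix id (fun _ : Unit => 0)) D).det := by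
  let φ := algebraMap R (FractionRing R)
  have hφ : Function.Injective φ := IsFractionRing.injective R (FractionRing R)
  have hdet : (D.map φ).det ≠ 0 := by
    have := φ.map_det D
    rw [RingHom.mapMatrix_apply] at this
    rw [← this]
    exact fun h => hD (hφ (by rw [h, map_zero]))
  have := aux_schur (B.map φ) (U.map φ) (V.map φ) (D.map φ) hdet
  apply hφ
  have hd : ∀ u v : R, B.map φ + diagonal ![φ u, φ v] = (B + diagonal ![u, v]).map φ := by
    intro u v
    ext i j
    fin_cases i <;> fin_cases j <;> simp [diagonal]
  have h10 := hd 1 0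
  have h01 := hd 0 1
  have h00 := hd 0 0
  have h11 := hd 1 1
  rw [map_one, map_zero] at h10 h01
  rw [map_zero] at h00
  rw [map_one] at h11
  rw [h10, h01, h00, h11] at this
  simp only [map_mul, map_sub, RingHom.map_det, RingHom.mapMatrix_apply, fromBlocks_map]
  simpa only [submatrix_map] using this

lemma aux_det_ne_zero {κ : Type*} [Fintype κ] [DecidableEq κ] (A : Matrix κ κ K) (w : κ → σ) :
    (diagonal (fun k => (X (w k) : MvPolynomial σ K)) + A.map C).det ≠ 0 := by
  intro h
  have h2 := congrArg (aeval (fun _ : σ => (Polynomial.X : Polynomial K))) h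
  rw [AlgHom.map_det, map_zero] at h2
  have : (aeval (fun _ : σ => (Polynomial.X : Polynomial K))).mapMatrix
      (diagonal (fun k => (X (w k) : MvPolynomial σ K)) + A.map C) = charmatrix (-A) := by
    ext1 i j
    by_cases hij : i = j
    · subst hij
      simp [Polynomial.algebraMap_eq]
    · simp [hij, Polynomial.algebraMap_eq]
  rw [this] at h2
  exact (charpoly_monic (-A)).ne_zero h2

lemma aux_det_deg {ι : Type*} [Fintype ι] [DecidableEq ι] (N : Matrix ι ι (MvPolynomial σ K))
    (t : σ) (j0 : ι) (h : ∀ i j, degreeOf t (N i j) ≤ if j = j0 then 1 else 0) :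
    degreeOf t N.det ≤ 1 := by
  rw [det_apply]
  refine (degreeOf_sum_le _ _ _).trans (Finset.sup_le fun τ _ => ?_)
  have h1 : degreeOf t (∏ i, N (τ i) i) ≤ 1 := by
    refine (degreeOf_prod_le _ _ _).trans ((Finset.sum_le_sum fun i _ => h (τ i) i).trans ?_)
    simp
  rcases Int.units_eq_one_or (Equiv.Perm.sign τ) with hs | hs <;> rw [hs]
  · simpa using h1
  · simpa [degreeOf_neg] using h1

lemma aux_det_deg0 {ι : Type*} [Fintype ι] [DecidableEq ι] (N : Matrix ι ι (MvPolynomial σ K))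
    (t : σ) (h : ∀ i j, degreeOf t (N i j) = 0) :
    degreeOf t N.det ≤ 1 := by
  rw [det_apply]
  refine (degreeOf_sum_le _ _ _).trans (Finset.sup_le fun τ _ => ?_)
  have h1 : degreeOf t (∏ i, N (τ i) i) ≤ 1 := by
    refine (degreeOf_prod_le _ _ _).trans ?_
    simp [h]
  rcases Int.units_eq_one_or (Equiv.Perm.sign τ) with hs | hs <;> rw [hs]
  · simpa using h1
  · simpa [degreeOf_neg] using h1

lemma aux_border_deg {κ : Type*} [Fintype κ] [DecidableEq κ] (w : κ → σ)
    (hw : Function.Injective w) (B : Matrix Unit Unit K) (U : Matrix Unit κ K)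
    (V : Matrix κ Unit K) (A : Matrix κ κ K) (t : σ) :
    degreeOf t (fromBlocks (B.map C) (U.map C) (V.map C)
      (diagonal (fun k => (X (w k) : MvPolynomial σ K)) + A.map C)).det ≤ 1 := by
  classical
  have hdeg : ∀ i j, degreeOf t
      ((diagonal (fun k => (X (w k) : MvPolynomial σ K)) + A.map C : Matrix κ κ _) i j)
      ≤ if t = w j then 1 else 0 := by
    intro i j
    rw [Matrix.add_apply]
    refine (degreeOf_add_le _ _ _).trans ?_
    rw [Matrix.map_apply, degreeOf_C]
    by_cases hij : i = j
    · subst hij; simp [degreeOf_X]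
    · simp [hij]
  by_cases ht : ∃ k, w k = t
  · obtain ⟨k, rfl⟩ := ht
    refine aux_det_deg _ _ (Sum.inr k) ?_
    rintro (i | i) (j | j)
    · simp
    · simp
    · simp
    · refine (hdeg i j).trans ?_
      simp [hw.eq_iff, eq_comm]
  · refine aux_det_deg0 _ _ ?_
    rintro (i | i) (j | j)
    · simp
    · simp
    · simp
    · refine Nat.le_zero.1 ((hdeg i j).trans ?_)
      rw [if_neg (fun h => ht ⟨j, h.symm⟩)]

/-- substitution of the two distinguished variables -/
noncomputable def auxSub {κ : Type*} (K : Type*) [Field K] (e : Fin 2 ⊕ κ ≃ σ)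
    (u v : MvPolynomial σ K) : MvPolynomial σ K →ₐ[K] MvPolynomial σ K :=
  aeval (fun t => Sum.elim ![u, v] (fun k => X (e (Sum.inr k))) (e.symm t))

lemma aux_dodgson {κ : Type*} [Fintype κ] [DecidableEq κ] [Fintype σ] [DecidableEq σ]
    (e : Fin 2 ⊕ κ ≃ σ) (A : Matrix σ σ K) (f : MvPolynomial σ K)
    (hf : f = (diagonal (fun t => (X t : MvPolynomial σ K)) + A.map C).det) :
    ∃ g h : MvPolynomial σ K,
      auxSub K e 1 0 f * auxSub K e 0 1 f - auxSub K e 0 0 f * auxSub K e 1 1 f = g * h ∧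
      (∀ t, g.degreeOf t ≤ 1) ∧ (∀ t, h.degreeOf t ≤ 1) := by
  let A' := A.submatrix e e
  let D : Matrix κ κ (MvPolynomial σ K) :=
    diagonal (fun k => (X (e (Sum.inr k)) : MvPolynomial σ K)) + A'.toBlocks₂₂.map C
  have hφ : ∀ u v, auxSub K e u v f = (fromBlocks (A'.toBlocks₁₁.map C + diagonal ![u, v])
      (A'.toBlocks₁₂.map C) (A'.toBlocks₂₁.map C) D).det := by
    intro u v
    rw [hf, AlgHom.map_det, ← det_submatrix_equiv_self e]
    congr 1
    have hC : ∀ a : K, auxSub K e u v (C a) = C a := fun a => by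
      simp [auxSub, MvPolynomial.algebraMap_eq]
    ext1 (i | i) (j | j)
    · by_cases hij : i = j
      · subst hij
        simp [A', hC, toBlocks₁₁]
        simp [auxSub, add_comm]
      · simp [A', hC, toBlocks₁₁, hij]
    · simp [A', hC, toBlocks₁₂]
    · simp [A', hC, toBlocks₂₁]
    · by_cases hij : i = j
      · subst hij
        simp [A', D, hC, toBlocks₂₂]
        simp [auxSub]
      · simp [A', D, hC, toBlocks₂₂, hij]
  have hw : Function.Injective (fun k => e (Sum.inr k)) := e.injective.comp Sum.inr_injective
  have key := aux_schur' (A'.toBlocks₁₁.map C) (A'.toBlocks₁₂.map C) (A'.toBlocks₂₁.map C) D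
    (aux_det_ne_zero _ _)
  rw [← hφ, ← hφ, ← hφ, ← hφ] at key
  refine ⟨_, _, key, ?_, ?_⟩
  · exact fun t => aux_border_deg (fun k => e (Sum.inr k)) hw
      (A'.toBlocks₁₁.submatrix (fun _ : Unit => 0) (fun _ : Unit => 1))
      (A'.toBlocks₁₂.submatrix (fun _ : Unit => 0) id)
      (A'.toBlocks₂₁.submatrix id (fun _ : Unit => 1)) A'.toBlocks₂₂ t
  · exact fun t => aux_border_deg (fun k => e (Sum.inr k)) hw
      (A'.toBlocks₁₁.submatrix (fun _ : Unit => 1) (fun _ : Unit => 0))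
      (A'.toBlocks₁₂.submatrix (fun _ : Unit => 1) id)
      (A'.toBlocks₂₁.submatrix id (fun _ : Unit => 0)) A'.toBlocks₂₂ t

lemma aux_prod {R : Type*} [CommRing R] (y : ℕ → R) (m : ℕ) :
    (∏ j ∈ Finset.range m, (y (2 * j + 3) * y (2 * j + 4) + 1)) *
      (∏ j ∈ Finset.range m, (y (2 * j + 4) * y (2 * j + 5) + 1)) =
    ∏ i ∈ Finset.Icc 3 (2 * (m + 1)), (y i * y (i + 1) + 1) := by
  induction m with
  | zero => simp
  | succ m ih =>
    rw [show 2 * (m + 1 + 1) = 2 * (m + 1) + 1 + 1 by ring,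
      Finset.prod_Icc_succ_top (by omega), Finset.prod_Icc_succ_top (by omega), ← ih,
      Finset.prod_range_succ, Finset.prod_range_succ]
    rw [show 2 * (m + 1) + 1 = 2 * m + 3 by ring]
    ring

lemma aux_fOdd (K : Type*) [Field K] (m : ℕ) (y : ℕ → MvPolynomial (Fin (2 * (m + 1) + 1)) K)
    (φ : MvPolynomial (Fin (2 * (m + 1) + 1)) K →ₐ[K] MvPolynomial (Fin (2 * (m + 1) + 1)) K)
    (u v : MvPolynomial (Fin (2 * (m + 1) + 1)) K)
    (h1 : φ (X (pIdx (m + 1) 1)) = u) (h2 : φ (X (pIdx (m + 1) 2)) = v)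
    (h3 : ∀ i, 3 ≤ i → i ≤ 2 * m + 3 → φ (X (pIdx (m + 1) i)) = y i) :
    φ (fOdd K (m + 1)) = u * ((∏ j ∈ Finset.range m, (y (2 * j + 3) * y (2 * j + 4) + 1)) *
        (y (2 * m + 3) * v + 1)) +
      (∏ j ∈ Finset.range m, (y (2 * j + 4) * y (2 * j + 5) + 1)) * (v * y 3 + 1) := by
  have hl : pIdx (m + 1) (2 * m + 4) = pIdx (m + 1) 2 := by
    ext
    simp [pIdx, show 2 * m + 4 = 2 * (m + 1) + 2 by ring]
  unfold fOdd
  rw [Finset.prod_range_succ, Finset.prod_range_succ', hl]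
  simp only [map_add, map_mul, map_prod, map_one, h1, h2, mul_zero, zero_add]
  rw [h3 (2 * m + 3) (by omega) (by omega), h3 3 (by omega) (by omega)]
  congr 1
  · congr 2
    refine Finset.prod_congr rfl fun j hj => ?_
    have := Finset.mem_range.1 hj
    rw [h3 _ (by omega) (by omega), h3 _ (by omega) (by omega)]
  · congr 1
    refine Finset.prod_congr rfl fun j hj => ?_
    have := Finset.mem_range.1 hj
    rw [show 2 * (j + 1) + 2 = 2 * j + 4 by ring, show 2 * (j + 1) + 3 = 2 * j + 5 by ring,
      h3 _ (by omega) (by omega), h3 _ (by omega) (by omega)]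

lemma aux_part2 (K : Type*) [Field K] (n : ℕ) (hn : 2 ≤ n)
    (A : Matrix (Fin (2 * n + 1)) (Fin (2 * n + 1)) K)
    (hA : fOdd K n = (diagonal (fun t => (X t : MvPolynomial (Fin (2 * n + 1)) K)) +
          A.map C).det) : False := by
  obtain ⟨m, rfl⟩ : ∃ m, n = m + 1 := ⟨n - 1, by omega⟩
  let e : Fin 2 ⊕ Fin (2 * m + 1) ≃ Fin (2 * (m + 1) + 1) :=
    finSumFinEquiv.trans (finCongr (by ring))
  obtain ⟨g, h, hgh, hg, hh⟩ := aux_dodgson e A _ hA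
  refine aux_part1 K (m + 1) hn g h ?_ hg hh
  rw [← hgh]
  have e0 : pIdx (m + 1) 1 = e (Sum.inl 0) := by
    ext
    rw [aux_pIdx_val _ _ (by omega) (by omega)]
    simp [e]
  have e1 : pIdx (m + 1) 2 = e (Sum.inl 1) := by
    ext
    rw [aux_pIdx_val _ _ (by omega) (by omega)]
    simp [e]
  have e2 : ∀ i, 3 ≤ i → i ≤ 2 * m + 3 → ∃ k, pIdx (m + 1) i = e (Sum.inr k) := by
    intro i h1 h2
    refine ⟨⟨i - 3, by omega⟩, ?_⟩
    ext
    rw [aux_pIdx_val _ _ (by omega) (by omega)]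
    simp [e]
    omega
  have hf : ∀ u v, _ := fun u v => aux_fOdd K m (fun i => X (pIdx (m + 1) i)) (auxSub K e u v) u v
    (by rw [e0]; simp [auxSub]) (by rw [e1]; simp [auxSub])
    (by
      intro i h1 h2
      obtain ⟨k, hk⟩ := e2 i h1 h2
      simp only [hk]
      simp [auxSub])
  rw [hf, hf, hf, hf, ← aux_prod (fun i => X (pIdx (m + 1) i)) m,
    show pIdx (m + 1) (2 * (m + 1) + 1) = pIdx (m + 1) (2 * m + 3) from rfl]
  ring

end aux

/-- the polynomial
`Δ₁₂(f_{2n+1}) = (x₃ − x_{2n+1})·∏_{i=3}^{2n}(x_i x_{i+1} + 1)` is not a product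
of two multiaffine polynomials over the algebraic closure of `𝔽`; consequently
`f_{2n+1}` has no determinantal representation `det(diag(x) + A)` over `𝔽`. -/
theorem stmt18 (F : Type*) [Field F] [CharZero F] (n : ℕ) (hn : 2 ≤ n) :
    (¬∃ g h : MvPolynomial (Fin (2 * n + 1)) (AlgebraicClosure F),
        ((X (pIdx n 3) - X (pIdx n (2 * n + 1))) *
            ∏ i ∈ Finset.Icc 3 (2 * n), (X (pIdx n i) * X (pIdx n (i + 1)) + 1)
          : MvPolynomial (Fin (2 * n + 1)) (AlgebraicClosure F)) = g * h ∧
        (∀ t, g.degreeOf t ≤ 1) ∧ (∀ t, h.degreeOf t ≤ 1)) ∧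
    ¬∃ A : Matrix (Fin (2 * n + 1)) (Fin (2 * n + 1)) F,
      fOdd F n =
        (Matrix.diagonal (fun t => (X t : MvPolynomial (Fin (2 * n + 1)) F)) +
          A.map C).det := by
  exact ⟨fun ⟨g, h, h1, h2, h3⟩ => aux_part1 _ n hn g h h1 h2 h3,
    fun ⟨A, hA⟩ => aux_part2 F n hn A hA⟩
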